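/- arXiv:2109.08493 — 6 statements merged into one kernel-verified Lean document; each statement's English description precedes it below -/
import Mathlib

section
/- Let G ∈ ℂ[x₀,…,x₅] be a homogeneous polynomial of degree 3 whose partial derivatives ∂₀G,…,∂₅G have no common zero in ℂ⁶ ∖ {0} (i.e. the cubic fourfold X = V(G) is smooth). If W ⊆ ℂ⁶ is a 2-dimensional subspace on which G vanishes identically, then the linear span of the restricted partial derivatives q₀ = ∂₀G|_W, …, q₅ = ∂₅G|_W in the space of quadratic forms on W has dimension at least 2 (hence exactly 2 or 3). -/
open MvPolynomial

/-- A linear form is additive and homogeneous along a pair of vectors. -/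
lemma MvPolynomial.IsHomogeneous.eval_smul_add_smul_of_one {σ R : Type*} [CommRing R]
    {P : MvPolynomial σ R} (hP : P.IsHomogeneous 1) (u v : σ → R) (s t : R) :
    eval (s • u + t • v) P = s * eval u P + t * eval v P := by
  rw [← mem_homogeneousSubmodule, homogeneousSubmodule_one_eq_span_X] at hP
  induction hP using Submodule.span_induction with
  | mem x hx =>
    obtain ⟨i, rfl⟩ := hx
    simp
  | zero => simp
  | add x y _ _ hx hy =>
    simp only [map_add, hx, hy]
    ring
  | smul a x _ hx =>
    simp only [smul_eval, hx]
    ring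

/-- A quadratic form restricted to the span of two vectors is a binary quadratic form. -/
lemma MvPolynomial.IsHomogeneous.exists_eval_smul_add_smul_of_two {σ R : Type*} [CommRing R]
    {P : MvPolynomial σ R} (hP : P.IsHomogeneous 2) (u v : σ → R) :
    ∃ a b c : R, ∀ s t : R, eval (s • u + t • v) P = a * s ^ 2 + b * (s * t) + c * t ^ 2 := by
  rw [← mem_homogeneousSubmodule, ← homogeneousSubmodule_one_pow, pow_two] at hP
  induction hP using Submodule.mul_induction_on' with
  | mem_mul_mem m hm n hn =>
    refine ⟨eval u m * eval u n, eval u m * eval v n + eval v m * eval u n,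
      eval v m * eval v n, fun s t => ?_⟩
    rw [map_mul, IsHomogeneous.eval_smul_add_smul_of_one hm,
      IsHomogeneous.eval_smul_add_smul_of_one hn]
    ring
  | add x _ y _ hx hy =>
    obtain ⟨a, b, c, h⟩ := hx
    obtain ⟨a', b', c', h'⟩ := hy
    refine ⟨a + a', b + b', c + c', fun s t => ?_⟩
    rw [map_add, h, h']
    ring

/-- A binary quadratic form over an algebraically closed field has a nontrivial zero. -/
lemma exists_binary_quadratic_eq_zero {K : Type*} [Field K] [IsAlgClosed K] [NeZero (2 : K)]
    (a b c : K) : ∃ s t : K, (s ≠ 0 ∨ t ≠ 0) ∧ a * s ^ 2 + b * (s * t) + c * t ^ 2 = 0 := by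
  by_cases ha : a = 0
  · exact ⟨1, 0, by simp, by simp [ha]⟩
  · obtain ⟨x, hx⟩ := exists_quadratic_eq_zero (b := b) (c := c) ha
      (IsAlgClosed.exists_eq_mul_self _)
    exact ⟨x, 1, by simp, by linear_combination hx⟩

/-- The functions `s²`, `st`, `t²` in the coordinates `s, t` of a two-dimensional space. -/
noncomputable def binaryQuadraticMonomials {K V : Type*} [Field K] [AddCommGroup V] [Module K V]
    (B : Module.Basis (Fin 2) K V) : Fin 3 → V → K :=
  ![fun p => B.repr p 0 ^ 2, fun p => B.repr p 0 * B.repr p 1, fun p => B.repr p 1 ^ 2]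

lemma mem_span_binaryQuadraticMonomials {K V : Type*} [Field K] [AddCommGroup V] [Module K V]
    (B : Module.Basis (Fin 2) K V) {q : V → K} :
    q ∈ Submodule.span K (Set.range (binaryQuadraticMonomials B)) ↔
      ∃ a b c : K, ∀ p, q p =
        a * B.repr p 0 ^ 2 + b * (B.repr p 0 * B.repr p 1) + c * B.repr p 1 ^ 2 := by
  rw [Submodule.mem_span_range_iff_exists_fun]
  constructor
  · rintro ⟨f, rfl⟩
    exact ⟨f 0, f 1, f 2, fun p => by simp [Fin.sum_univ_three, binaryQuadraticMonomials]⟩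
  · rintro ⟨a, b, c, h⟩
    refine ⟨![a, b, c], funext fun p => ?_⟩
    simp [Fin.sum_univ_three, binaryQuadraticMonomials, h]

/-- Let `G` be a homogeneous cubic in `ℂ[x₀,…,x₅]` whose partial
derivatives have no common zero in `ℂ⁶ ∖ {0}` (i.e. the cubic fourfold `V(G)` is smooth).
If `W ⊆ ℂ⁶` is a 2-dimensional subspace on which `G` vanishes identically, then the span of
the restricted partials `qᵢ = ∂ᵢG|_W` (viewed as functions `W → ℂ`) has dimension at least
2 (hence exactly 2 or 3). -/
theorem statement_3 (G : MvPolynomial (Fin 6) ℂ) (hG : G.IsHomogeneous 3)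
    (hsmooth : ∀ x : Fin 6 → ℂ, x ≠ 0 → ∃ i : Fin 6, eval x (pderiv i G) ≠ 0)
    (W : Submodule ℂ (Fin 6 → ℂ)) (hW : Module.finrank ℂ W = 2)
    (hvanish : ∀ p ∈ W, eval p G = 0) :
    2 ≤ Module.finrank ℂ (Submodule.span ℂ
      (Set.range (fun i : Fin 6 => fun p : W => eval (p : Fin 6 → ℂ) (pderiv i G)))) ∧
    Module.finrank ℂ (Submodule.span ℂ
      (Set.range (fun i : Fin 6 => fun p : W => eval (p : Fin 6 → ℂ) (pderiv i G)))) ≤ 3 := by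
  let B : Module.Basis (Fin 2) ℂ W := Module.finBasisOfFinrankEq ℂ W hW
  set S := Submodule.span ℂ
    (Set.range (fun i : Fin 6 => fun p : W => eval (p : Fin 6 → ℂ) (pderiv i G))) with hS
  have hle : S ≤ Submodule.span ℂ (Set.range (binaryQuadraticMonomials B)) := by
    rw [hS, Submodule.span_le]
    rintro _ ⟨i, rfl⟩
    obtain ⟨a, b, c, h⟩ := IsHomogeneous.exists_eval_smul_add_smul_of_two
      (hG.pderiv (i := i)) (B 0 : Fin 6 → ℂ) (B 1 : Fin 6 → ℂ)
    refine (mem_span_binaryQuadraticMonomials B).2 ⟨a, b, c, fun p => ?_⟩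
    rw [← h, ← Submodule.coe_smul, ← Submodule.coe_smul, ← Submodule.coe_add,
      ← Fin.sum_univ_two (fun j => B.repr p j • B j), B.sum_repr]
  have : Module.Finite ℂ S := Module.Finite.span_of_finite ℂ (Set.finite_range _)
  have : Module.Finite ℂ (Submodule.span ℂ (Set.range (binaryQuadraticMonomials B))) :=
    Module.Finite.span_of_finite ℂ (Set.finite_range _)
  constructor
  · by_contra! hlt
    obtain ⟨q, hq⟩ := finrank_le_one_iff.1 (Nat.le_of_lt_succ hlt)
    obtain ⟨a, b, c, habc⟩ := (mem_span_binaryQuadraticMonomials B).1 (hle q.2)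
    obtain ⟨s, t, hst, hzero⟩ := exists_binary_quadratic_eq_zero a b c
    let p : W := B.equivFun.symm ![s, t]
    have hs : B.repr p 0 = s := by
      rw [← B.equivFun_apply, LinearEquiv.apply_symm_apply]; rfl
    have ht : B.repr p 1 = t := by
      rw [← B.equivFun_apply, LinearEquiv.apply_symm_apply]; rfl
    have hp : (p : Fin 6 → ℂ) ≠ 0 := by
      intro h
      have h0 : p = 0 := Subtype.ext h
      rw [h0] at hs ht
      simp_all
    obtain ⟨i, hi⟩ := hsmooth p hp
    obtain ⟨k, hk⟩ := hq ⟨_, Submodule.subset_span ⟨i, rfl⟩⟩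
    refine hi ?_
    have hkp := congrFun (congrArg Subtype.val hk) p
    refine hkp.symm.trans ?_
    rw [Submodule.coe_smul, Pi.smul_apply, habc, hs, ht, hzero, smul_zero]
  · exact (Submodule.finrank_mono hle).trans
      ((finrank_range_le_card (binaryQuadraticMonomials B)).trans (by simp))
end

section
/- For (κ,λ) ∈ ℂ², let M(κ,λ) be the 10×12 matrix over ℂ whose rows are: r₁ = (κ,0,λ,0,0,0,0,0,0,0,0,0); r₂ = (0,0,κ,κ,0,λ,0,0,0,0,0,0); r₃ = (λ,λ,κ,0,0,0,κ,0,λ,0,0,0); r₄ = (0,λ,κ,0,0,κ,0,0,0,0,0,0); r₅ = (λ,κ,0,λ,λ,κ,0,0,κ,0,0,0); r₆ = (0,0,0,0,0,0,λ,λ,κ,κ,0,0); r₇ = (0,0,0,0,λ,κ,0,0,0,0,0,0); r₈ = (0,0,0,λ,κ,0,0,λ,κ,0,0,0); r₉ = (0,0,0,0,0,0,λ,κ,0,0,κ,0); r₁₀ = (0,0,0,0,0,0,0,0,0,0,0,1). Then for every (κ,λ) ≠ (0,0), the matrix M(κ,λ) has rank 10 (equivalently, its 10×10 minors have no common zero on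 ℂ² ∖ {(0,0)}). -/
/-- The explicit 10×12 matrix `M(κ,λ)` from the irreducibility proof for the
universal surface of triple lines has rank 10 for every `(κ,λ) ≠ (0,0)`. -/
theorem statement_6 (κ lam : ℂ) (h : (κ, lam) ≠ (0, 0)) :
    (!![κ,   0,   lam, 0,   0,   0,   0,   0,   0,   0,   0,   0;
        0,   0,   κ,   κ,   0,   lam, 0,   0,   0,   0,   0,   0;
        lam, lam, κ,   0,   0,   0,   κ,   0,   lam, 0,   0,   0;
        0,   lam, κ,   0,   0,   κ,   0,   0,   0,   0,   0,   0;
        lam, κ,   0,   lam, lam, κ,   0,   0,   κ,   0,   0,   0;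
        0,   0,   0,   0,   0,   0,   lam, lam, κ,   κ,   0,   0;
        0,   0,   0,   0,   lam, κ,   0,   0,   0,   0,   0,   0;
        0,   0,   0,   lam, κ,   0,   0,   lam, κ,   0,   0,   0;
        0,   0,   0,   0,   0,   0,   lam, κ,   0,   0,   κ,   0;
        0,   0,   0,   0,   0,   0,   0,   0,   0,   0,   0,   1] :
      Matrix (Fin 10) (Fin 12) ℂ).rank = 10 := by
  refine (LinearIndependent.rank_matrix ?_).trans (Fintype.card_fin 10)
  rw [← Matrix.vecMul_injective_iff, ← Matrix.coe_vecMulLinear, ← LinearMap.ker_eq_bot,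
    LinearMap.ker_eq_bot']
  intro a ha
  rw [Matrix.vecMulLinear_apply] at ha
  have c1 := congrFun ha 0
  have c2 := congrFun ha 1
  have c3 := congrFun ha 2
  have c4 := congrFun ha 3
  have c5 := congrFun ha 4
  have c6 := congrFun ha 5
  have c7 := congrFun ha 6
  have c8 := congrFun ha 7
  have c9 := congrFun ha 8
  have c10 := congrFun ha 9
  have c11 := congrFun ha 10
  have c12 := congrFun ha 11
  simp [Matrix.vecMul, dotProduct, Fin.sum_univ_succ] at c1 c2 c3 c4 c5 c6 c7 c8 c9 c10 c11 c12
  suffices a 0 = 0 ∧ a 1 = 0 ∧ a 2 = 0 ∧ a 3 = 0 ∧ a 4 = 0 ∧ a 5 = 0 ∧ a 6 = 0 ∧ a 7 = 0 ∧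
      a 8 = 0 by
    obtain ⟨h0, h1, h2, h3, h4, h5, h6, h7, h8⟩ := this
    funext i
    fin_cases i <;> assumption
  by_cases hk : κ = 0
  · have hl : lam ≠ 0 := fun hl => h (by rw [hk, hl])
    have h0 : a 0 = 0 := by simpa [hk, hl] using c3
    have h1 : a 1 = 0 := by simpa [hk, hl] using c6
    have h2 : a 2 = 0 := by simpa [hk, hl] using c9
    have h4 : a 4 = 0 := by simpa [hk, hl, h2] using c1
    have h3 : a 3 = 0 := by simpa [hk, hl, h2] using c2
    have h7 : a 7 = 0 := by simpa [hk, hl, h4] using c4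
    have h6 : a 6 = 0 := by simpa [hk, hl, h4] using c5
    have h5 : a 5 = 0 := by simpa [hk, hl, h7] using c8
    have h8 : a 8 = 0 := by simpa [hk, hl, h5] using c7
    exact ⟨h0, h1, h2, h3, h4, h5, h6, h7, h8⟩
  · have h5 : a 5 = 0 := c10.resolve_right hk
    have h8 : a 8 = 0 := c11.resolve_right hk
    have h2 : a 2 = 0 := by simpa [hk, h5, h8] using c7
    have e7 : a 7 * lam = 0 := by simpa [h5, h8] using c8
    have e4 : a 4 = -a 7 := mul_right_cancel₀ hk (by linear_combination c9 - lam * h2 - κ * h5)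
    have h1 : a 1 = 0 := by simpa [hk, e4] using c4
    have h0 : a 0 = 0 := by simpa [hk, h2, e4, e7] using c1
    have h3 : a 3 = 0 := by simpa [hk, h0, h1, h2] using c3
    have e6 : a 6 = a 7 := mul_right_cancel₀ hk (by
      linear_combination c6 - lam * h1 - κ * h3 - κ * e4)
    have h7 : a 7 = 0 := by simpa [hk, e4, e6] using c5
    exact ⟨h0, h1, h2, h3, by rw [e4, h7, neg_zero], h5, e6.trans h7, h7, h8⟩
end

section
/- The polynomial R = (x₁y₃ − x₃y₁)² − (x₁y₂ − x₂y₁)(x₂y₃ − x₃y₂) is irreducible in the polynomial ring ℂ[x₁, x₂, x₃, y₁, y₂, y₃]. -/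
open MvPolynomial

/-- A quadratic polynomial over a domain is irreducible if its leading and constant coefficients
have only unit common divisors and its discriminant is not a square. -/
theorem irreducible_quadratic_of_not_isSquare_discrim {D : Type*} [CommRing D] [IsDomain D]
    {a b c : D} (ha : a ≠ 0) (hac : IsRelPrime a c) (hd : ¬ IsSquare (discrim a b c)) :
    Irreducible (Polynomial.C a * Polynomial.X ^ 2 + Polynomial.C b * Polynomial.X
      + Polynomial.C c) := by
  set p := Polynomial.C a * Polynomial.X ^ 2 + Polynomial.C b * Polynomial.X + Polynomial.C c
    with hp
  have hdeg : p.natDegree = 2 := Polynomial.natDegree_quadratic ha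
  have hcoeff : ∀ u v w : D, p = Polynomial.C u * Polynomial.X ^ 2 + Polynomial.C v * Polynomial.X
      + Polynomial.C w → p.coeff 2 = u ∧ p.coeff 1 = v ∧ p.coeff 0 = w := by
    rintro u v w h
    rw [h]
    refine ⟨?_, ?_, ?_⟩ <;> simp [Polynomial.coeff_X, Polynomial.coeff_C]
  obtain ⟨hp2, hp1, hp0⟩ := hcoeff a b c hp
  have hconst : ∀ u : D, Polynomial.C u ∣ p → IsUnit u := by
    intro u hu
    rw [Polynomial.C_dvd_iff_dvd_coeff] at hu
    exact hac (hp2 ▸ hu 2) (hp0 ▸ hu 0)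
  refine ⟨fun hu => ?_, fun f g hfg => ?_⟩
  · have := Polynomial.natDegree_eq_zero_of_isUnit hu
    omega
  have hf0 : f ≠ 0 := by
    rintro rfl
    simp [hfg] at hdeg
  have hg0 : g ≠ 0 := by
    rintro rfl
    simp [hfg] at hdeg
  have hsum : f.natDegree + g.natDegree = 2 := by
    rw [← Polynomial.natDegree_mul hf0 hg0, ← hfg, hdeg]
  rcases Nat.eq_zero_or_pos f.natDegree with hf | hf
  · left
    rw [Polynomial.eq_C_of_natDegree_eq_zero hf] at hfg ⊢
    exact (hconst _ ⟨g, hfg⟩).map Polynomial.C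
  rcases Nat.eq_zero_or_pos g.natDegree with hg | hg
  · right
    rw [Polynomial.eq_C_of_natDegree_eq_zero hg] at hfg ⊢
    exact (hconst _ ⟨f, by rw [hfg, mul_comm]⟩).map Polynomial.C
  obtain ⟨a₁, b₁, rfl⟩ := Polynomial.exists_eq_X_add_C_of_natDegree_le_one
    (show f.natDegree ≤ 1 by omega)
  obtain ⟨a₂, b₂, rfl⟩ := Polynomial.exists_eq_X_add_C_of_natDegree_le_one
    (show g.natDegree ≤ 1 by omega)
  have hprod : p = Polynomial.C (a₁ * a₂) * Polynomial.X ^ 2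
      + Polynomial.C (a₁ * b₂ + b₁ * a₂) * Polynomial.X + Polynomial.C (b₁ * b₂) := by
    rw [hfg]
    simp only [map_add, map_mul]
    ring
  obtain ⟨ha', hb', hc'⟩ := hcoeff _ _ _ hprod
  refine absurd ⟨a₁ * b₂ - b₁ * a₂, ?_⟩ hd
  rw [discrim, ← hp2, ← hp1, ← hp0, ha', hb', hc']
  ring

/-- The resultant
`R = (x₁y₃ − x₃y₁)² − (x₁y₂ − x₂y₁)(x₂y₃ − x₃y₂)` is irreducible in
`ℂ[x₁,x₂,x₃,y₁,y₂,y₃]` (variables `x₁,x₂,x₃,y₁,y₂,y₃` are `X 0, …, X 5`). -/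
theorem statement_8 :
    Irreducible ((X 0 * X 5 - X 2 * X 3) ^ 2
      - (X 0 * X 4 - X 1 * X 3) * (X 1 * X 5 - X 2 * X 4) :
        MvPolynomial (Fin 6) ℂ) := by
  rw [← MulEquiv.irreducible_iff (finSuccEquiv ℂ 5)]
  have h1 : finSuccEquiv ℂ 5 (X 1) = Polynomial.C (X 0) := finSuccEquiv_X_succ (j := 0)
  have h2 : finSuccEquiv ℂ 5 (X 2) = Polynomial.C (X 1) := finSuccEquiv_X_succ (j := 1)
  have h3 : finSuccEquiv ℂ 5 (X 3) = Polynomial.C (X 2) := finSuccEquiv_X_succ (j := 2)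
  have h4 : finSuccEquiv ℂ 5 (X 4) = Polynomial.C (X 3) := finSuccEquiv_X_succ (j := 3)
  have h5 : finSuccEquiv ℂ 5 (X 5) = Polynomial.C (X 4) := finSuccEquiv_X_succ (j := 4)
  convert irreducible_quadratic_of_not_isSquare_discrim (D := MvPolynomial (Fin 5) ℂ)
    (a := X 4 ^ 2)
    (b := X 1 * X 3 ^ 2 - 2 * X 1 * X 2 * X 4 - X 0 * X 3 * X 4)
    (c := X 1 ^ 2 * X 2 ^ 2 + X 0 ^ 2 * X 2 * X 4 - X 0 * X 1 * X 2 * X 3) ?_ ?_ ?_ using 1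
  · simp only [map_sub, map_mul, map_pow, map_add, finSuccEquiv_X_zero, h1, h2, h3, h4, h5,
      map_ofNat]
    ring
  · exact pow_ne_zero 2 (X_ne_zero 4)
  · refine IsRelPrime.pow_left ((X_prime (i := 4)).irreducible.isRelPrime_iff_not_dvd.2 ?_)
    rintro ⟨q, hq⟩
    have := congrArg (eval ![0, 1, 1, 0, (0 : ℂ)]) hq
    simp at this
  · rintro ⟨s, hs⟩
    have h := congrArg (aeval ![1, 0, Polynomial.X, 0, (1 : Polynomial ℂ)]) hs
    have hdeg := congrArg Polynomial.natDegree h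
    rw [map_mul, ← sq, Polynomial.natDegree_pow] at hdeg
    have hX : (-(4 * Polynomial.X) : Polynomial ℂ).natDegree = 1 := by
      rw [Polynomial.natDegree_neg]
      exact Polynomial.natDegree_C_mul_X (4 : ℂ) (by norm_num)
    simp [discrim, hX] at hdeg
    omega
end

section
/- Let R = (x₁y₃ − x₃y₁)² − (x₁y₂ − x₂y₁)(x₂y₃ − x₃y₂) ∈ ℂ[x₁,x₂,x₃,y₁,y₂,y₃]. For a point (x₁,x₂,x₃,y₁,y₂,y₃) ∈ ℂ⁶, all six partial derivatives of R vanish at that point if and only if the 2×3 matrix with rows (x₁,x₂,x₃) and (y₁,y₂,y₃) has rank at most 1, i.e. if and only if x₁y₂ − x₂y₁ = x₁y₃ − x₃y₁ = x₂y₃ − x₃y₂ = 0. -/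
open MvPolynomial

/-- Let `R = (x₁y₃ − x₃y₁)² − (x₁y₂ − x₂y₁)(x₂y₃ − x₃y₂)` (with the
variables `x₁,x₂,x₃,y₁,y₂,y₃` being `X 0, …, X 5`).  All six partial derivatives of `R`
vanish at a point `(x₁,x₂,x₃,y₁,y₂,y₃) ∈ ℂ⁶` if and only if the 2×3 matrix with rows
`(x₁,x₂,x₃)` and `(y₁,y₂,y₃)` has rank at most 1, i.e. all three 2×2 minors vanish. -/
theorem statement_9 (x₁ x₂ x₃ y₁ y₂ y₃ : ℂ) :
    (∀ i : Fin 6, eval ![x₁, x₂, x₃, y₁, y₂, y₃]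
        (pderiv i ((X 0 * X 5 - X 2 * X 3) ^ 2
          - (X 0 * X 4 - X 1 * X 3) * (X 1 * X 5 - X 2 * X 4) :
            MvPolynomial (Fin 6) ℂ)) = 0) ↔
    (x₁ * y₂ - x₂ * y₁ = 0 ∧ x₁ * y₃ - x₃ * y₁ = 0 ∧ x₂ * y₃ - x₃ * y₂ = 0) := by
  have key : ∀ i : Fin 6, eval ![x₁, x₂, x₃, y₁, y₂, y₃]
      (pderiv i ((X 0 * X 5 - X 2 * X 3) ^ 2
        - (X 0 * X 4 - X 1 * X 3) * (X 1 * X 5 - X 2 * X 4) : MvPolynomial (Fin 6) ℂ)) =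
      ![2 * (x₁ * y₃ - x₃ * y₁) * y₃ - (x₂ * y₃ - x₃ * y₂) * y₂,
        (x₂ * y₃ - x₃ * y₂) * y₁ - (x₁ * y₂ - x₂ * y₁) * y₃,
        (x₁ * y₂ - x₂ * y₁) * y₂ - 2 * (x₁ * y₃ - x₃ * y₁) * y₁,
        (x₂ * y₃ - x₃ * y₂) * x₂ - 2 * (x₁ * y₃ - x₃ * y₁) * x₃,
        (x₁ * y₂ - x₂ * y₁) * x₃ - (x₂ * y₃ - x₃ * y₂) * x₁,
        2 * (x₁ * y₃ - x₃ * y₁) * x₁ - (x₁ * y₂ - x₂ * y₁) * x₂] i := by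
    intro i
    fin_cases i <;> simp [pderiv_X, Derivation.leibniz_pow] <;> ring
  simp only [key]
  constructor
  · intro h
    have h0 := h 0
    have h2 := h 2
    have h3 := h 3
    have h5 := h 5
    simp only [Matrix.cons_val] at h0 h2 h3 h5
    have hp : x₁ * y₂ - x₂ * y₁ = 0 := by
      apply pow_eq_zero_iff two_ne_zero |>.mp
      linear_combination x₁ * h2 + y₁ * h5
    have hr : x₂ * y₃ - x₃ * y₂ = 0 := by
      apply pow_eq_zero_iff two_ne_zero |>.mp
      linear_combination x₃ * h0 + y₃ * h3
    have hq : x₁ * y₃ - x₃ * y₁ = 0 := by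
      apply pow_eq_zero_iff two_ne_zero |>.mp
      linear_combination (x₁ * h0 + y₁ * h3 + (x₂ * y₃ - x₃ * y₂) * hp) / 2
    exact ⟨hp, hq, hr⟩
  · rintro ⟨hp, hq, hr⟩ i
    rw [hp, hq, hr]
    fin_cases i <;> simp
end

section
/- Let Z ⊆ ℂ⁸ (with coordinates w, w′, x₁, x₂, x₃, y₁, y₂, y₃) be the common zero locus of the six polynomials: wx₃ − w′y₃; wx₂ − w′y₂ + x₃y₁ − x₁y₃; wx₁ − w′y₁ + x₂y₁ − x₁y₂; w′² − w′x₂ + x₁x₃; ww′ − w′y₂ + x₃y₁; w² − wy₂ + y₁y₃. Then the image of Z under the projection (w,w′,x₁,x₂,x₃,y₁,y₂,y₃) ↦ (x₁,x₂,x₃,y₁,y₂,y₃) is exactly the zero locus in ℂ⁶ of R = (x₁y₃ − x₃y₁)² − (x₁y₂ − x₂y₁)(x₂y₃ − x₃y₂). -/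
/-- The six equations cutting out the (cone over the) normalization `R^ν` of the resultant
hypersurface, in coordinates `(w, w′, x₁, x₂, x₃, y₁, y₂, y₃)`. -/
def normalizationEqs (w w' x₁ x₂ x₃ y₁ y₂ y₃ : ℂ) : Prop :=
  w * x₃ - w' * y₃ = 0 ∧
  w * x₂ - w' * y₂ + x₃ * y₁ - x₁ * y₃ = 0 ∧
  w * x₁ - w' * y₁ + x₂ * y₁ - x₁ * y₂ = 0 ∧
  w' ^ 2 - w' * x₂ + x₁ * x₃ = 0 ∧
  w * w' - w' * y₂ + x₃ * y₁ = 0 ∧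
  w ^ 2 - w * y₂ + y₁ * y₃ = 0

/-- A complex quadratic with nonzero leading coefficient has a root. -/
lemma exists_root_quadratic {a : ℂ} (ha : a ≠ 0) (b c : ℂ) :
    ∃ k : ℂ, c - k * b + k ^ 2 * a = 0 := by
  obtain ⟨d, hd⟩ := IsAlgClosed.exists_pow_nat_eq (b ^ 2 - 4 * a * c) (n := 2) two_pos
  refine ⟨(b + d) / (2 * a), ?_⟩
  field_simp
  linear_combination hd

/-- If `[1 : -k]` is a common root of two binary quadratic forms, then `(k * y₃, k * x₃)` lifts
the pair of forms to the normalization. -/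
lemma normalizationEqs_of_common_root {k x₁ x₂ x₃ y₁ y₂ y₃ : ℂ}
    (hx : x₁ - k * x₂ + k ^ 2 * x₃ = 0) (hy : y₁ - k * y₂ + k ^ 2 * y₃ = 0) :
    normalizationEqs (k * y₃) (k * x₃) x₁ x₂ x₃ y₁ y₂ y₃ := by
  refine ⟨by ring, ?_, ?_, ?_, ?_, ?_⟩
  · linear_combination x₃ * hy - y₃ * hx
  · linear_combination (k * y₃ - y₂) * hx - (k * x₃ - x₂) * hy
  · linear_combination x₃ * hx
  · linear_combination x₃ * hy
  · linear_combination y₃ * hy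

/-- The image of the common zero locus `Z ⊆ ℂ⁸` of the six polynomials
under the projection forgetting `(w, w′)` is exactly the zero locus of the resultant
`R = (x₁y₃ − x₃y₁)² − (x₁y₂ − x₂y₁)(x₂y₃ − x₃y₂)` in `ℂ⁶`. -/
theorem statement_10 (x₁ x₂ x₃ y₁ y₂ y₃ : ℂ) :
    (∃ w w' : ℂ, normalizationEqs w w' x₁ x₂ x₃ y₁ y₂ y₃) ↔
    (x₁ * y₃ - x₃ * y₁) ^ 2 - (x₁ * y₂ - x₂ * y₁) * (x₂ * y₃ - x₃ * y₂) = 0 := by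
  constructor
  · rintro ⟨w, w', h₁, h₂, h₃, -, -, -⟩
    linear_combination (x₁ * y₂ - x₂ * y₁) * h₁ - (x₁ * y₃ - x₃ * y₁) * h₂ +
      (x₂ * y₃ - x₃ * y₂) * h₃
  · intro hR
    by_cases hC : x₂ * y₃ - x₃ * y₂ = 0
    · have hA : x₁ * y₃ - x₃ * y₁ = 0 := by
        rw [hC, mul_zero, sub_zero] at hR
        exact (pow_eq_zero_iff two_ne_zero).mp hR
      by_cases hx₃ : x₃ = 0
      · by_cases hy₃ : y₃ = 0
        · subst hx₃ hy₃
          exact ⟨y₂, x₂, by ring, by ring, by ring, by ring, by ring, by ring⟩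
        · obtain ⟨k, hk⟩ := exists_root_quadratic hy₃ y₂ y₁
          refine ⟨_, _, normalizationEqs_of_common_root (mul_left_cancel₀ hy₃ ?_) hk⟩
          linear_combination x₃ * hk + hA - k * hC
      · obtain ⟨k, hk⟩ := exists_root_quadratic hx₃ x₂ x₁
        refine ⟨_, _, normalizationEqs_of_common_root hk (mul_left_cancel₀ hx₃ ?_)⟩
        linear_combination y₃ * hk - hA + k * hC
    · obtain ⟨k, hk⟩ : ∃ k, k * (x₂ * y₃ - x₃ * y₂) = x₁ * y₃ - x₃ * y₁ :=
        ⟨_, div_mul_cancel₀ _ hC⟩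
      have hB : k * (x₁ * y₃ - x₃ * y₁) = x₁ * y₂ - x₂ * y₁ := by
        refine mul_left_cancel₀ hC ?_
        linear_combination (x₁ * y₃ - x₃ * y₁) * hk + hR
      refine ⟨_, _, normalizationEqs_of_common_root (k := k)
        (mul_left_cancel₀ hC ?_) (mul_left_cancel₀ hC ?_)⟩
      · linear_combination (k * x₃ - x₂) * hk + x₃ * hB
      · linear_combination (k * y₃ - y₂) * hk + y₃ * hB
end

section
/- Let Z ⊆ ℂ⁸ be the common zero locus of the six polynomials wx₃ − w′y₃; wx₂ − w′y₂ + x₃y₁ − x₁y₃; wx₁ − w′y₁ + x₂y₁ − x₁y₂; w′² − w′x₂ + x₁x₃; ww′ − w′y₂ + x₃y₁; w² − wy₂ + y₁y₃ in the coordinates (w, w′, x₁, x₂, x₃, y₁, y₂, y₃). Fix t ∈ ℂ and x = (x₁,x₂,x₃) ∈ ℂ³ ∖ {0}, and consider the point (x₁,x₂,x₃, tx₁, tx₂, tx₃) ∈ ℂ⁶ (so the matrix with rows x and tx has rank ≤ 1). Then the fiber of the projection Z → ℂ⁶, (w,w′,x,y) ↦ (x,y), over this point is exactly the set of points (tw′,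 w′, x₁, x₂, x₃, tx₁, tx₂, tx₃) where w′ ranges over the roots of the quadratic equation w′² − w′x₂ + x₁x₃ = 0; in particular this fiber has exactly two points when x₂² ≠ 4x₁x₃ and exactly one point when x₂² = 4x₁x₃. -/
/-- Over a point `(x, t·x)` with `x ≠ 0`, the six equations reduce to `w = t·w′` and a quadratic
equation for `w′`. -/
theorem normalizationEqs_smul_iff {t x₁ x₂ x₃ : ℂ} (hx : (x₁, x₂, x₃) ≠ (0, 0, 0)) (w w' : ℂ) :
    normalizationEqs w w' x₁ x₂ x₃ (t * x₁) (t * x₂) (t * x₃) ↔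
      (w = t * w' ∧ w' ^ 2 - w' * x₂ + x₁ * x₃ = 0) := by
  constructor
  · rintro ⟨e₁, e₂, e₃, hq, -, -⟩
    refine ⟨?_, hq⟩
    by_contra hne
    have hsub : w - t * w' ≠ 0 := sub_ne_zero.mpr hne
    have h₁ : x₁ = 0 := (mul_eq_zero_iff_left hsub).mp (by linear_combination e₃)
    have h₂ : x₂ = 0 := (mul_eq_zero_iff_left hsub).mp (by linear_combination e₂)
    have h₃ : x₃ = 0 := (mul_eq_zero_iff_left hsub).mp (by linear_combination e₁)
    exact hx (by rw [h₁, h₂, h₃])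
  · rintro ⟨rfl, hq⟩
    refine ⟨by ring, by ring, by ring, hq, ?_, ?_⟩
    · linear_combination t * hq
    · linear_combination t ^ 2 * hq

/-- The fiber over `(x, t·x)` in terms of a square root `s` of the discriminant. -/
theorem setOf_normalizationEqs_smul_eq_pair {t x₁ x₂ x₃ s : ℂ}
    (hx : (x₁, x₂, x₃) ≠ (0, 0, 0)) (hs : s ^ 2 = x₂ ^ 2 - 4 * (x₁ * x₃)) :
    {p : ℂ × ℂ | normalizationEqs p.1 p.2 x₁ x₂ x₃ (t * x₁) (t * x₂) (t * x₃)} =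
      {(t * ((x₂ + s) / 2), (x₂ + s) / 2), (t * ((x₂ - s) / 2), (x₂ - s) / 2)} := by
  ext ⟨w, w'⟩
  have hroots : w' ^ 2 - w' * x₂ + x₁ * x₃ = 0 ↔ w' = (x₂ + s) / 2 ∨ w' = (x₂ - s) / 2 := by
    rw [← sub_eq_zero (b := (x₂ + s) / 2), ← sub_eq_zero (b := (x₂ - s) / 2), ← mul_eq_zero]
    have hfactor : w' ^ 2 - w' * x₂ + x₁ * x₃ =
        (w' - (x₂ + s) / 2) * (w' - (x₂ - s) / 2) := by
      linear_combination hs / 4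
    rw [hfactor]
  simp only [Set.mem_ofPred_eq, Set.mem_insert_iff, Set.mem_singleton_iff, Prod.mk.injEq,
    normalizationEqs_smul_iff hx, hroots]
  constructor
  · rintro ⟨rfl, rfl | rfl⟩ <;> simp
  · rintro (⟨rfl, rfl⟩ | ⟨rfl, rfl⟩) <;> simp

/-- For `t ∈ ℂ`, `x = (x₁,x₂,x₃) ≠ 0`, and `y = t·x` (so the matrix with
rows `x` and `y` has rank ≤ 1), the fiber of `Z → ℂ⁶` over `(x, tx)` consists exactly of the
points `(t·w′, w′)` with `w′² − w′x₂ + x₁x₃ = 0`; in particular it has exactly two points if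
`x₂² ≠ 4x₁x₃`, and exactly one point if `x₂² = 4x₁x₃`. -/
theorem statement_11 (t x₁ x₂ x₃ : ℂ) (hx : (x₁, x₂, x₃) ≠ (0, 0, 0)) :
    (∀ w w' : ℂ,
      normalizationEqs w w' x₁ x₂ x₃ (t * x₁) (t * x₂) (t * x₃) ↔
        (w = t * w' ∧ w' ^ 2 - w' * x₂ + x₁ * x₃ = 0)) ∧
    (x₂ ^ 2 ≠ 4 * (x₁ * x₃) →
      {p : ℂ × ℂ |
        normalizationEqs p.1 p.2 x₁ x₂ x₃ (t * x₁) (t * x₂) (t * x₃)}.ncard = 2) ∧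
    (x₂ ^ 2 = 4 * (x₁ * x₃) →
      {p : ℂ × ℂ |
        normalizationEqs p.1 p.2 x₁ x₂ x₃ (t * x₁) (t * x₂) (t * x₃)}.ncard = 1) := by
  obtain ⟨s, hs⟩ := IsAlgClosed.exists_pow_nat_eq (x₂ ^ 2 - 4 * (x₁ * x₃)) two_pos
  refine ⟨normalizationEqs_smul_iff hx, fun hne => ?_, fun heq => ?_⟩
  · rw [setOf_normalizationEqs_smul_eq_pair hx hs]
    refine Set.ncard_pair fun h => hne ?_
    have hs0 : s = 0 := by linear_combination (Prod.ext_iff.mp h).2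
    rw [hs0] at hs
    linear_combination -hs
  · have hs0 : (0 : ℂ) ^ 2 = x₂ ^ 2 - 4 * (x₁ * x₃) := by linear_combination -heq
    rw [setOf_normalizationEqs_smul_eq_pair hx hs0]
    simp
end
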